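/- arXiv:2007.15998 — 5 statements merged into one kernel-verified Lean document; each statement's English description precedes it below -/
import Mathlib

section
/- Let d₁, d₂ ≥ 1, L ≥ 0, and let G : ℝ^{d₁} × ℝ^{d₂} → ℝ^{d₂} be L-Lipschitz. Fix s ≥ 0 and let a : [s,∞) → ℝ^{d₁} and b : [s,∞) → ℝ^{d₂} be continuous. Let ā : [s,∞) → ℝ^{d₁} be the constant function ā(t) = a(s), and let b̄ : [s,∞) → ℝ^{d₂} be differentiable with b̄(s) = b(s) and b̄'(t) = −G(ā(t), b̄(t)) for all t ≥ s. Suppose Ω : [s,∞) → [0,∞) is nondecreasing and satisfies, for all t ≥ s, ‖a(t) − a(s)‖ + ‖b(t) − b(s) + ∫_s^t G(a(u), b(u)) du‖ ≤ Ω(t). Then for all t ≥ s, ‖a(t) − ā(t)‖ + ‖b(t) − b̄(t)‖ ≤ Ω(t) e^{L(t−s)}. -/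
open Set Filter Topology MeasureTheory in
/-- Grönwall's inequality in integral form: if `f` is continuous on `[s, T]` and
`f t ≤ C + L * ∫ u in s..t, f u` there, with `f, L, C ≥ 0`, then `f t ≤ C * exp (L * (t - s))`. -/
theorem le_mul_exp_of_le_add_mul_integral {f : ℝ → ℝ} {s T L C : ℝ} (hL : 0 ≤ L) (hC : 0 ≤ C)
    (hf : ContinuousOn f (Icc s T)) (hf0 : ∀ t ∈ Icc s T, 0 ≤ f t)
    (hle : ∀ t ∈ Icc s T, f t ≤ C + L * ∫ u in s..t, f u) :
    ∀ t ∈ Icc s T, f t ≤ C * Real.exp (L * (t - s)) := by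
  intro t ht
  have hsT : s ≤ T := ht.1.trans ht.2
  have hint : IntegrableOn f (Icc s T) := hf.integrableOn_Icc
  have hcont : ContinuousOn (fun x => C + L * ∫ u in s..x, f u) (Icc s T) := by
    have := intervalIntegral.continuousOn_primitive_interval (μ := volume)
      (by rwa [uIcc_of_le hsT] : IntegrableOn f (uIcc s T))
    rw [uIcc_of_le hsT] at this
    exact continuousOn_const.add (continuousOn_const.mul this)
  have hderiv : ∀ x ∈ Ico s T,
      HasDerivWithinAt (fun x => C + L * ∫ u in s..x, f u) (L * f x) (Ici x) x := by
    intro x hx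
    have hsub : Ioo x T ⊆ Icc s T := fun y hy => ⟨hx.1.trans hy.1.le, hy.2.le⟩
    have hmeas : StronglyMeasurableAtFilter f (𝓝[>] x) volume :=
      ⟨Ioo x T, Ioo_mem_nhdsGT hx.2,
        (hf.mono hsub).aestronglyMeasurable measurableSet_Ioo⟩
    have hcx : ContinuousWithinAt f (Ioi x) x :=
      (hf x ⟨hx.1, hx.2.le⟩).mono_of_mem_nhdsWithin
        (mem_of_superset (Ioo_mem_nhdsGT hx.2) hsub)
    have hii : IntervalIntegrable f volume s x :=
      (hf.mono (Icc_subset_Icc_right hx.2.le)).intervalIntegrable_of_Icc hx.1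
    exact ((intervalIntegral.integral_hasDerivWithinAt_right hii hmeas hcx).const_mul L).const_add C
  have hnonneg : ∀ x ∈ Icc s T, 0 ≤ C + L * ∫ u in s..x, f u := fun x hx =>
    (hf0 x hx).trans (hle x hx)
  have key := norm_le_gronwallBound_of_norm_deriv_right_le (δ := C) (K := L) (ε := 0)
    hcont hderiv (by simp [abs_of_nonneg hC]) (by
      intro x hx
      have hx' : x ∈ Icc s T := ⟨hx.1, hx.2.le⟩
      rw [Real.norm_of_nonneg (mul_nonneg hL (hf0 x hx')), Real.norm_of_nonneg (hnonneg x hx'),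
        add_zero]
      exact mul_le_mul_of_nonneg_left (hle x hx') hL) t ht
  rw [gronwallBound_ε0] at key
  exact (hle t ht).trans ((le_abs_self _).trans key)

open Filter Topology in
/-- A map of two variables that is Lipschitz for the sum of the norms is jointly continuous. -/
theorem continuous_uncurry_of_norm_sub_le {E F H : Type*} [SeminormedAddCommGroup E]
    [SeminormedAddCommGroup F] [SeminormedAddCommGroup H] {G : E → F → H} {L : ℝ}
    (hG : ∀ x₁ x₂ y₁ y₂, ‖G x₁ y₁ - G x₂ y₂‖ ≤ L * (‖x₁ - x₂‖ + ‖y₁ - y₂‖)) :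
    Continuous (Function.uncurry G) := by
  rw [continuous_iff_continuousAt]
  intro p
  refine tendsto_iff_norm_sub_tendsto_zero.2
    (squeeze_zero (fun _ => norm_nonneg _) (fun q => hG q.1 p.1 q.2 p.2) ?_)
  have : Continuous fun q : E × F => L * (‖q.1 - p.1‖ + ‖q.2 - p.2‖) := by fun_prop
  simpa using this.tendsto p


theorem stmt2 {d₁ d₂ : ℕ} (hd₁ : 1 ≤ d₁) (hd₂ : 1 ≤ d₂)
    (L : ℝ) (hL : 0 ≤ L)
    (G : EuclideanSpace ℝ (Fin d₁) → EuclideanSpace ℝ (Fin d₂) → EuclideanSpace ℝ (Fin d₂))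
    (hG : ∀ x₁ x₂ y₁ y₂, ‖G x₁ y₁ - G x₂ y₂‖ ≤ L * (‖x₁ - x₂‖ + ‖y₁ - y₂‖))
    (s : ℝ) (hs : 0 ≤ s)
    (a : ℝ → EuclideanSpace ℝ (Fin d₁)) (b bbar : ℝ → EuclideanSpace ℝ (Fin d₂))
    (ha : ContinuousOn a (Set.Ici s)) (hb : ContinuousOn b (Set.Ici s))
    (hbbar0 : bbar s = b s)
    (hbbar : ∀ t ≥ s, HasDerivAt bbar (-(G (a s) (bbar t))) t)
    (Ω : ℝ → ℝ)
    (hΩ0 : ∀ t ≥ s, 0 ≤ Ω t)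
    (hΩmono : MonotoneOn Ω (Set.Ici s))
    (hbound : ∀ t ≥ s,
      ‖a t - a s‖ + ‖b t - b s + ∫ u in s..t, G (a u) (b u)‖ ≤ Ω t) :
    ∀ t ≥ s, ‖a t - a s‖ + ‖b t - bbar t‖ ≤ Ω t * Real.exp (L * (t - s)) := by
  have hGc := continuous_uncurry_of_norm_sub_le hG
  have hbb : ContinuousOn bbar (Set.Ici s) := fun t ht =>
    (hbbar t ht).continuousAt.continuousWithinAt
  have hGab : ContinuousOn (fun u => G (a u) (b u)) (Set.Ici s) :=
    hGc.comp_continuousOn (ha.prodMk hb)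
  have hGbar : ContinuousOn (fun u => G (a s) (bbar u)) (Set.Ici s) :=
    hGc.comp_continuousOn (continuousOn_const.prodMk hbb)
  have he : ContinuousOn (fun t => ‖a t - a s‖ + ‖b t - bbar t‖) (Set.Ici s) :=
    (ha.sub continuousOn_const).norm.add (hb.sub hbb).norm
  have hle : ∀ t ≥ s, ‖a t - a s‖ + ‖b t - bbar t‖ ≤
      Ω t + L * ∫ u in s..t, (‖a u - a s‖ + ‖b u - bbar u‖) := by
    intro t ht
    have hi₁ := (hGab.mono Set.Icc_subset_Ici_self).intervalIntegrable_of_Icc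
      (μ := MeasureTheory.volume) ht
    have hi₂ := (hGbar.mono Set.Icc_subset_Ici_self).intervalIntegrable_of_Icc
      (μ := MeasureTheory.volume) ht
    have hie := (he.mono Set.Icc_subset_Ici_self).intervalIntegrable_of_Icc
      (μ := MeasureTheory.volume) ht
    have hftc : ∫ u in s..t, -G (a s) (bbar u) = bbar t - bbar s :=
      intervalIntegral.integral_eq_sub_of_hasDerivAt
        (fun u hu => hbbar u (by rw [Set.uIcc_of_le ht] at hu; exact hu.1)) hi₂.neg
    rw [intervalIntegral.integral_neg, hbbar0] at hftc
    have hdecomp : b t - bbar t = (b t - b s + ∫ u in s..t, G (a u) (b u)) -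
        ∫ u in s..t, (G (a u) (b u) - G (a s) (bbar u)) := by
      rw [intervalIntegral.integral_sub hi₁ hi₂, eq_add_of_sub_eq hftc.symm]
      abel
    have hdiff : ‖∫ u in s..t, (G (a u) (b u) - G (a s) (bbar u))‖ ≤
        L * ∫ u in s..t, (‖a u - a s‖ + ‖b u - bbar u‖) := by
      rw [← intervalIntegral.integral_const_mul]
      exact intervalIntegral.norm_integral_le_of_norm_le ht
        (Filter.Eventually.of_forall fun u _ => hG _ _ _ _) (hie.const_mul L)
    have hnorm := norm_sub_le (b t - b s + ∫ u in s..t, G (a u) (b u))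
      (∫ u in s..t, (G (a u) (b u) - G (a s) (bbar u)))
    rw [← hdecomp] at hnorm
    linarith [hbound t ht]
  intro T hT
  refine le_mul_exp_of_le_add_mul_integral hL (hΩ0 T hT) (he.mono Set.Icc_subset_Ici_self)
    (fun t _ => by positivity) (fun t ht => (hle t ht.1).trans ?_) T ⟨hT, le_rfl⟩
  gcongr
  exact hΩmono ht.1 hT ht.2
end

section
/- Let d₁, d₂ ≥ 1, L ≥ 0, K ≥ 0. Let G : ℝ^{d₁} × ℝ^{d₂} → ℝ^{d₂} be L-Lipschitz. Let r : [0,∞) → [0,∞) be continuous with r(t) → 0 as t → ∞, let h : [0,∞) → ℝ^{d₁} be continuous with ‖h(t)‖ ≤ K for all t, and let e₁ : [0,∞) → ℝ^{d₁}, e₂ : [0,∞) → ℝ^{d₂} be continuous such that for every T > 0 and i = 1, 2, lim_{s→∞} sup_{t∈[s,s+T]} ‖e_i(t) − e_i(s)‖ = 0. Let a : [0,∞) → ℝ^{d₁} and b : [0,∞) → ℝ^{d₂} be continuous and satisfy, for all 0 ≤ s ≤ t, a(t) = a(s) − ∫_s^t r(u) h(u) du − (e₁(t) − e₁(s)) and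 b(t) = b(s) − ∫_s^t G(a(u), b(u)) du − (e₂(t) − e₂(s)). For each s ≥ 0 let b̄^{(s)} : [s,∞) → ℝ^{d₂} denote the unique solution of b̄'(t) = −G(a(s), b̄(t)) with b̄^{(s)}(s) = b(s). Then for every T > 0, lim_{s→∞} sup_{t∈[s,s+T]} ( ‖a(t) − a(s)‖ + ‖b(t) − b̄^{(s)}(t)‖ ) = 0. -/
open Filter

/-- The Grönwall bound with zero initial value and inhomogeneity `L * c`. -/
theorem gronwallBound_zero_mul (L c x : ℝ) :
    gronwallBound 0 L (L * c) x = c * (Real.exp (L * x) - 1) := by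
  rcases eq_or_ne L 0 with rfl | hL
  · simp [gronwallBound_K0]
  · rw [gronwallBound_of_K_ne_0 hL]
    field_simp
    ring

/-- Integral form of Grönwall's inequality: a continuous function whose norm is controlled by
the norm of its own primitive has a primitive of at most exponential growth. -/
theorem norm_integral_le_of_norm_le_mul_norm_integral_add {E : Type*} [NormedAddCommGroup E]
    [NormedSpace ℝ E] [CompleteSpace E] {F : ℝ → E} {L c s : ℝ}
    (hF : ContinuousOn F (Set.Ici s)) {t : ℝ} (hst : s ≤ t)
    (hbound : ∀ u ∈ Set.Icc s t, ‖F u‖ ≤ L * (‖∫ v in s..u, F v‖ + c)) :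
    ‖∫ v in s..t, F v‖ ≤ c * (Real.exp (L * (t - s)) - 1) := by
  have hcont : Continuous fun u => F (max s u) :=
    hF.comp_continuous (by fun_prop) fun u => le_max_left s u
  have heq : ∀ u ≥ s, ∫ v in s..u, F v = ∫ v in s..u, F (max s v) := by
    intro u hu
    refine intervalIntegral.integral_congr fun v hv => ?_
    rw [Set.uIcc_of_le hu] at hv
    simp only [max_eq_right hv.1]
  have hderiv : ∀ u, HasDerivAt (fun u => ∫ v in s..u, F (max s v)) (F (max s u)) u :=
    fun u => (hcont.integral_hasStrictDerivAt s u).hasDerivAt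
  have key := norm_le_gronwallBound_of_norm_deriv_right_le
    (f := fun u => ∫ v in s..u, F (max s v)) (f' := fun u => F (max s u))
    (δ := 0) (K := L) (ε := L * c) (a := s) (b := t)
    (fun u _ => (hderiv u).continuousAt.continuousWithinAt)
    (fun u _ => (hderiv u).hasDerivWithinAt) (by simp)
    (fun u hu => by
      rw [max_eq_right hu.1, ← heq u hu.1, ← mul_add]
      exact hbound u ⟨hu.1, hu.2.le⟩) t ⟨hst, le_rfl⟩
  rw [gronwallBound_zero_mul] at key
  rwa [heq t hst]

theorem stmt3 {d₁ d₂ : ℕ} (hd₁ : 1 ≤ d₁) (hd₂ : 1 ≤ d₂)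
    (L K : ℝ) (hL : 0 ≤ L) (hK : 0 ≤ K)
    (G : EuclideanSpace ℝ (Fin d₁) → EuclideanSpace ℝ (Fin d₂) → EuclideanSpace ℝ (Fin d₂))
    (hG : ∀ x₁ x₂ y₁ y₂, ‖G x₁ y₁ - G x₂ y₂‖ ≤ L * (‖x₁ - x₂‖ + ‖y₁ - y₂‖))
    (r : ℝ → ℝ) (hrcont : Continuous r) (hrnn : ∀ t ≥ (0:ℝ), 0 ≤ r t)
    (hrlim : Tendsto r atTop (nhds 0))
    (h : ℝ → EuclideanSpace ℝ (Fin d₁))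
    (hhcont : Continuous h) (hhbdd : ∀ t ≥ (0:ℝ), ‖h t‖ ≤ K)
    (e₁ : ℝ → EuclideanSpace ℝ (Fin d₁)) (e₂ : ℝ → EuclideanSpace ℝ (Fin d₂))
    (he₁cont : Continuous e₁) (he₂cont : Continuous e₂)
    (he₁ : ∀ T > (0:ℝ), ∀ ε > (0:ℝ), ∃ s₀ : ℝ, ∀ s ≥ s₀,
      ∀ t ∈ Set.Icc s (s + T), ‖e₁ t - e₁ s‖ ≤ ε)
    (he₂ : ∀ T > (0:ℝ), ∀ ε > (0:ℝ), ∃ s₀ : ℝ, ∀ s ≥ s₀,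
      ∀ t ∈ Set.Icc s (s + T), ‖e₂ t - e₂ s‖ ≤ ε)
    (a : ℝ → EuclideanSpace ℝ (Fin d₁)) (b : ℝ → EuclideanSpace ℝ (Fin d₂))
    (hacont : ContinuousOn a (Set.Ici (0:ℝ))) (hbcont : ContinuousOn b (Set.Ici (0:ℝ)))
    (haeq : ∀ s t : ℝ, 0 ≤ s → s ≤ t →
      a t = a s - (∫ u in s..t, r u • h u) - (e₁ t - e₁ s))
    (hbeq : ∀ s t : ℝ, 0 ≤ s → s ≤ t →
      b t = b s - (∫ u in s..t, G (a u) (b u)) - (e₂ t - e₂ s))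
    (bb : ℝ → ℝ → EuclideanSpace ℝ (Fin d₂))
    (hbb : ∀ s ≥ (0:ℝ), bb s s = b s ∧
      ∀ t ≥ s, HasDerivAt (bb s) (-(G (a s) (bb s t))) t) :
    ∀ T > (0:ℝ), ∀ ε > (0:ℝ), ∃ s₀ : ℝ, ∀ s ≥ s₀,
      ∀ t ∈ Set.Icc s (s + T), ‖a t - a s‖ + ‖b t - bb s t‖ ≤ ε := by
  intro T hT ε hε
  have hLip : LipschitzWith (2 * L).toNNReal fun p : EuclideanSpace ℝ (Fin d₁) ×
      EuclideanSpace ℝ (Fin d₂) => G p.1 p.2 := by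
    refine LipschitzWith.of_dist_le_mul fun p q => ?_
    rw [Real.coe_toNNReal _ (by positivity), dist_eq_norm, dist_eq_norm]
    refine (hG _ _ _ _).trans ?_
    have h1 := norm_fst_le (p - q)
    have h2 := norm_snd_le (p - q)
    rw [Prod.fst_sub] at h1
    rw [Prod.snd_sub] at h2
    nlinarith
  have hGcont := hLip.continuous
  obtain ⟨δ, hδ, hδε⟩ : ∃ δ > 0, δ * ((T * K + 2) * Real.exp (L * T)) = ε :=
    ⟨ε / ((T * K + 2) * Real.exp (L * T)), by positivity, by field_simp⟩
  obtain ⟨s₁, hs₁⟩ := he₁ T hT δ hδ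
  obtain ⟨s₂, hs₂⟩ := he₂ T hT δ hδ
  obtain ⟨s₃, hs₃⟩ := eventually_atTop.1 (hrlim.eventually_le_const hδ)
  refine ⟨max 0 (max s₁ (max s₂ s₃)), fun s hs t ht => ?_⟩
  simp only [ge_iff_le, max_le_iff] at hs
  obtain ⟨hs0, hss₁, hss₂, hss₃⟩ := hs
  have hslow : ∀ u ∈ Set.Icc s (s + T), ‖a u - a s‖ ≤ δ * (T * K + 1) := by
    intro u hu
    have hint : ‖∫ v in s..u, r v • h v‖ ≤ δ * K * |u - s| := by
      refine intervalIntegral.norm_integral_le_of_norm_le_const fun v hv => ?_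
      rw [Set.uIoc_of_le hu.1] at hv
      have hv0 : 0 ≤ v := hs0.trans hv.1.le
      rw [norm_smul, Real.norm_of_nonneg (hrnn v hv0)]
      exact mul_le_mul (hs₃ v (hss₃.trans hv.1.le)) (hhbdd v hv0) (norm_nonneg _) hδ.le
    rw [abs_of_nonneg (sub_nonneg.2 hu.1)] at hint
    have hint' : δ * K * (u - s) ≤ δ * K * T :=
      mul_le_mul_of_nonneg_left (by linarith [hu.2]) (by positivity)
    have heu := hs₁ s hss₁ u hu
    have hau : a u - a s = -(∫ v in s..u, r v • h v) - (e₁ u - e₁ s) := by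
      rw [haeq s u hs0 hu.1]
      abel
    have hnorm := norm_sub_le (-(∫ v in s..u, r v • h v)) (e₁ u - e₁ s)
    rw [norm_neg, ← hau] at hnorm
    linarith
  obtain ⟨hbbs, hbbd⟩ := hbb s hs0
  have hbbcont : ContinuousOn (bb s) (Set.Ici s) :=
    fun u hu => (hbbd u hu).continuousAt.continuousWithinAt
  have hsub : Set.Ici s ⊆ Set.Ici (0 : ℝ) := Set.Ici_subset_Ici.2 hs0
  have hGab : ContinuousOn (fun u => G (a u) (b u)) (Set.Ici s) :=
    hGcont.comp_continuousOn ((hacont.mono hsub).prodMk (hbcont.mono hsub))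
  have hGbb : ContinuousOn (fun u => G (a s) (bb s u)) (Set.Ici s) :=
    hGcont.comp_continuousOn (continuousOn_const.prodMk hbbcont)
  have hII : ∀ {F : ℝ → EuclideanSpace ℝ (Fin d₂)}, ContinuousOn F (Set.Ici s) →
      ∀ u ≥ s, IntervalIntegrable F MeasureTheory.volume s u := fun hF u hu =>
    (hF.mono Set.Icc_subset_Ici_self).intervalIntegrable_of_Icc hu
  have hdiff : ∀ u ≥ s, b u - bb s u =
      -(∫ v in s..u, (G (a v) (b v) - G (a s) (bb s v))) - (e₂ u - e₂ s) := by
    intro u hu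
    have hftc : ∫ v in s..u, -(G (a s) (bb s v)) = bb s u - bb s s := by
      refine intervalIntegral.integral_eq_sub_of_hasDerivAt (fun v hv => ?_) (hII hGbb.neg u hu)
      rw [Set.uIcc_of_le hu] at hv
      exact hbbd v hv.1
    rw [intervalIntegral.integral_neg, hbbs] at hftc
    rw [intervalIntegral.integral_sub (hII hGab u hu) (hII hGbb u hu), hbeq s u hs0 hu,
      eq_add_of_sub_eq hftc.symm]
    abel
  have hfast : ∀ u ∈ Set.Icc s (s + T), ‖b u - bb s u‖ ≤
      ‖∫ v in s..u, (G (a v) (b v) - G (a s) (bb s v))‖ + δ := by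
    intro u hu
    rw [hdiff u hu.1]
    refine (norm_sub_le _ _).trans ?_
    rw [norm_neg]
    gcongr
    exact hs₂ s hss₂ u hu
  have hgron := norm_integral_le_of_norm_le_mul_norm_integral_add
    (F := fun v => G (a v) (b v) - G (a s) (bb s v)) (L := L)
    (c := δ * (T * K + 2)) (hGab.sub hGbb) ht.1 fun u hu => by
      have hu' : u ∈ Set.Icc s (s + T) := ⟨hu.1, hu.2.trans ht.2⟩
      refine (hG _ _ _ _).trans (mul_le_mul_of_nonneg_left ?_ hL)
      have := hslow u hu'
      have := hfast u hu'
      linarith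
  have hexp : δ * (T * K + 2) * (Real.exp (L * (t - s)) - 1) ≤
      δ * (T * K + 2) * (Real.exp (L * T) - 1) := by
    gcongr
    linarith [ht.2]
  have h1 := hslow t ht
  have h2 := hfast t ht
  linarith
end

section
/- Let d₁, d₂ ≥ 1, L ≥ 0, L' ≥ 0. Let F : ℝ^{d₁} × ℝ^{d₂} → ℝ^{d₁} be L-Lipschitz and let λ : ℝ^{d₁} → ℝ^{d₂} be L'-Lipschitz. Let a : [0,∞) → ℝ^{d₁} and b : [0,∞) → ℝ^{d₂} be continuous with lim_{u→∞} ‖b(u) − λ(a(u))‖ = 0, and let e : [0,∞) → ℝ^{d₁} be continuous such that for every T > 0, lim_{s→∞} sup_{t∈[s,s+T]} ‖e(t) − e(s)‖ = 0. Suppose a(t) = a(s) − ∫_s^t F(a(u), b(u)) du − (e(t) − e(s)) for all 0 ≤ s ≤ t. For each s ≥ 0 let ā^{(s)} : [s,∞) → ℝ^{d₁} denote the unique solution of ā'(t) = −F(ā(t), λ(ā(t))) with ā^{(s)}(s) = a(s). Then for every T > 0, lim_{s→∞} sup_{t∈[s,s+T]} ‖a(t) − ā^{(s)}(t)‖ =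 0. -/
open Filter

/-- A trajectory of `x' = -F x y` perturbed by a path `e` of oscillation at most `η`, whose companion
`y` is `η`-close to `lam x`, stays Grönwall-close to the solution of `z' = -F z (lam z)` with the same
initial value. -/
theorem norm_sub_le_gronwallBound_of_perturbed_integral_eq
    {E G : Type*} [NormedAddCommGroup E] [NormedSpace ℝ E] [CompleteSpace E]
    [NormedAddCommGroup G] {L L' η s r : ℝ} (hL : 0 ≤ L) (hL' : 0 ≤ L')
    {F : E → G → E} (hF : ∀ x₁ x₂ y₁ y₂, ‖F x₁ y₁ - F x₂ y₂‖ ≤ L * (‖x₁ - x₂‖ + ‖y₁ - y₂‖))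
    {lam : E → G} (hlam : ∀ x₁ x₂, ‖lam x₁ - lam x₂‖ ≤ L' * ‖x₁ - x₂‖)
    {a e z : ℝ → E} {b : ℝ → G} (hs : 0 < s)
    (hcont : ContinuousOn (fun u => F (a u) (b u)) (Set.Ici 0))
    (hlock : ∀ t ∈ Set.Icc s r, ‖b t - lam (a t)‖ ≤ η)
    (he : ∀ t ∈ Set.Icc s r, ‖e t - e s‖ ≤ η)
    (haeq : ∀ t ≥ s, a t = a s - (∫ u in s..t, F (a u) (b u)) - (e t - e s))
    (hzs : z s = a s) (hz : ∀ t ≥ s, HasDerivAt z (-(F (z t) (lam (z t)))) t) :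
    ∀ t ∈ Set.Icc s r,
      ‖a t - z t‖ ≤ η + gronwallBound 0 (L * (1 + L')) (L * (2 + L') * η) (t - s) := by
  set f : ℝ → E := fun t => a s - (∫ u in s..t, F (a u) (b u)) - z t with hf
  have hfa : ∀ t ≥ s, a t - z t = f t - (e t - e s) := by
    intro t ht
    rw [haeq t ht]
    simp only [hf]
    abel
  have hdiff : ∀ t ≥ s, HasDerivAt f (-(F (a t) (b t)) - -(F (z t) (lam (z t)))) t := by
    intro t ht
    have ht0 : 0 < t := hs.trans_le ht
    have hsub : Set.uIcc s t ⊆ Set.Ici 0 := by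
      rw [Set.uIcc_of_le ht]
      exact fun u hu => hs.le.trans hu.1
    have hI := intervalIntegral.integral_hasDerivAt_right
      ((hcont.mono hsub).intervalIntegrable)
      ((hcont.mono Set.Ioi_subset_Ici_self).stronglyMeasurableAtFilter isOpen_Ioi t ht0)
      (hcont.continuousAt (Ici_mem_nhds ht0))
    exact (hI.const_sub (a s)).sub (hz t ht)
  have hbound : ∀ t ∈ Set.Icc s r, ‖f t‖ ≤
      gronwallBound 0 (L * (1 + L')) (L * (2 + L') * η) (t - s) := by
    refine norm_le_gronwallBound_of_norm_deriv_right_le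
      (fun t ht => (hdiff t ht.1).continuousAt.continuousWithinAt)
      (fun t ht => (hdiff t ht.1).hasDerivWithinAt) (by simp [hf, hzs]) ?_
    intro t ht
    have ht' := Set.Ico_subset_Icc_self ht
    have h₁ : ‖a t - z t‖ ≤ ‖f t‖ + η := by
      rw [hfa t ht.1]
      exact (norm_sub_le _ _).trans (by gcongr; exact he t ht')
    have h₂ : ‖b t - lam (z t)‖ ≤ η + L' * (‖f t‖ + η) :=
      calc ‖b t - lam (z t)‖ ≤ ‖b t - lam (a t)‖ + ‖lam (a t) - lam (z t)‖ :=
            norm_sub_le_norm_sub_add_norm_sub _ _ _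
        _ ≤ η + L' * (‖f t‖ + η) :=
            add_le_add (hlock t ht') ((hlam _ _).trans (by gcongr))
    calc ‖-(F (a t) (b t)) - -(F (z t) (lam (z t)))‖
        = ‖F (a t) (b t) - F (z t) (lam (z t))‖ := by rw [← norm_neg]; congr 1; abel
      _ ≤ L * (‖a t - z t‖ + ‖b t - lam (z t)‖) := hF _ _ _ _
      _ ≤ L * ((‖f t‖ + η) + (η + L' * (‖f t‖ + η))) := by gcongr
      _ = L * (1 + L') * ‖f t‖ + L * (2 + L') * η := by ring
  intro t ht
  rw [hfa t ht.1]
  linarith [norm_sub_le (f t) (e t - e s), he t ht, hbound t ht]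

theorem stmt4 {d₁ d₂ : ℕ} (hd₁ : 1 ≤ d₁) (hd₂ : 1 ≤ d₂)
    (L L' : ℝ) (hL : 0 ≤ L) (hL' : 0 ≤ L')
    (F : EuclideanSpace ℝ (Fin d₁) → EuclideanSpace ℝ (Fin d₂) → EuclideanSpace ℝ (Fin d₁))
    (hF : ∀ x₁ x₂ y₁ y₂, ‖F x₁ y₁ - F x₂ y₂‖ ≤ L * (‖x₁ - x₂‖ + ‖y₁ - y₂‖))
    (lam : EuclideanSpace ℝ (Fin d₁) → EuclideanSpace ℝ (Fin d₂))
    (hlam : ∀ x₁ x₂, ‖lam x₁ - lam x₂‖ ≤ L' * ‖x₁ - x₂‖)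
    (a : ℝ → EuclideanSpace ℝ (Fin d₁)) (b : ℝ → EuclideanSpace ℝ (Fin d₂))
    (hacont : ContinuousOn a (Set.Ici (0:ℝ))) (hbcont : ContinuousOn b (Set.Ici (0:ℝ)))
    (hlock : Tendsto (fun u => ‖b u - lam (a u)‖) atTop (nhds 0))
    (e : ℝ → EuclideanSpace ℝ (Fin d₁))
    (hecont : Continuous e)
    (he : ∀ T > (0:ℝ), ∀ ε > (0:ℝ), ∃ s₀ : ℝ, ∀ s ≥ s₀,
      ∀ t ∈ Set.Icc s (s + T), ‖e t - e s‖ ≤ ε)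
    (haeq : ∀ s t : ℝ, 0 ≤ s → s ≤ t →
      a t = a s - (∫ u in s..t, F (a u) (b u)) - (e t - e s))
    (abar : ℝ → ℝ → EuclideanSpace ℝ (Fin d₁))
    (habar : ∀ s ≥ (0:ℝ), abar s s = a s ∧
      ∀ t ≥ s, HasDerivAt (abar s) (-(F (abar s t) (lam (abar s t)))) t) :
    ∀ T > (0:ℝ), ∀ ε > (0:ℝ), ∃ s₀ : ℝ, ∀ s ≥ s₀,
      ∀ t ∈ Set.Icc s (s + T), ‖a t - abar s t‖ ≤ ε := by
  intro T hT ε hε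
  have hcont : ContinuousOn (fun u => F (a u) (b u)) (Set.Ici 0) := by
    have hFc : Continuous (fun p : EuclideanSpace ℝ (Fin d₁) × EuclideanSpace ℝ (Fin d₂) =>
        F p.1 p.2) := by
      refine continuous_iff_continuousAt.2 fun p => tendsto_iff_norm_sub_tendsto_zero.2 ?_
      refine squeeze_zero (fun _ => norm_nonneg _) (fun q => hF q.1 p.1 q.2 p.2) ?_
      have : Continuous (fun q : EuclideanSpace ℝ (Fin d₁) × EuclideanSpace ℝ (Fin d₂) =>
        L * (‖q.1 - p.1‖ + ‖q.2 - p.2‖)) := by fun_prop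
      simpa using this.tendsto p
    exact hFc.comp_continuousOn (hacont.prodMk hbcont)
  have hsmall : Tendsto (fun η : ℝ =>
      η + gronwallBound 0 (L * (1 + L')) (L * (2 + L') * η) T) (nhds 0) (nhds 0) := by
    have : Continuous (fun η : ℝ =>
        η + gronwallBound 0 (L * (1 + L')) (L * (2 + L') * η) T) :=
      continuous_id.add ((gronwallBound_continuous_ε _ _ _).comp (continuous_const.mul continuous_id))
    simpa [gronwallBound_ε0_δ0] using this.tendsto 0
  obtain ⟨η, hηε, hη⟩ := (((hsmall.eventually_lt_const hε).filter_mono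
    (nhdsWithin_le_nhds (s := Set.Ioi 0))).and self_mem_nhdsWithin).exists
  replace hη : 0 < η := hη
  obtain ⟨s₁, hs₁⟩ := he T hT η hη
  obtain ⟨s₂, hs₂⟩ := eventually_atTop.1 (hlock.eventually_lt_const hη)
  refine ⟨max 1 (max s₁ s₂), fun s hs t ht => ?_⟩
  obtain ⟨h1, h2, h3⟩ : 1 ≤ s ∧ s₁ ≤ s ∧ s₂ ≤ s := by simpa using hs
  have hs0 : 0 < s := zero_lt_one.trans_le h1
  obtain ⟨hzs, hz⟩ := habar s hs0.le
  have key := norm_sub_le_gronwallBound_of_perturbed_integral_eq hL hL' hF hlam hs0 hcont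
    (fun u hu => (hs₂ u (h3.trans hu.1)).le) (hs₁ s h2) (fun u hu => haeq s u hs0.le hu) hzs hz t ht
  have hmono : gronwallBound 0 (L * (1 + L')) (L * (2 + L') * η) (t - s) ≤
      gronwallBound 0 (L * (1 + L')) (L * (2 + L') * η) T :=
    gronwallBound_mono le_rfl (by positivity) (by positivity) (by linarith [ht.2])
  linarith
end

section
/- Let d₁, d₂ ≥ 1, let g : ℝ^{d₁} × ℝ^{d₂} → ℝ be twice continuously differentiable, let λ : ℝ^{d₁} → ℝ^{d₂} be differentiable with ∇_β g(α, λ(α)) = 0 for all α, and suppose the partial Hessian H(α₀) := ∇²_{ββ}g(α₀, λ(α₀)), regarded as a linear map ℝ^{d₂} → ℝ^{d₂}, is invertible at a point α₀. Let f : ℝ^{d₁} × ℝ^{d₂} → ℝ be continuously differentiable and set F(α) := f(α, λ(α)). Then F is differentiable at α₀ and ∇F(α₀) = ∇_α f(α₀, λ(α₀)) − (D_α ∇_β g(α₀, λ(α₀)))* ( H(α₀)⁻¹ ∇_β f(α₀, λ(α₀)) ), where D_α ∇_β g(α, β) : ℝ^{d₁} → ℝ^{d₂} is the mixed second derivative and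 (·)* denotes the adjoint. Equivalently, ∇F(α₀) = ∇̄f(α₀, λ(α₀)), where ∇̄f denotes the surrogate gradient. -/
/-- The gradient of `g` in its second variable: `∇_β g(α, β)`. -/
noncomputable def gradSnd {d₁ d₂ : ℕ}
    (g : EuclideanSpace ℝ (Fin d₁) × EuclideanSpace ℝ (Fin d₂) → ℝ)
    (α : EuclideanSpace ℝ (Fin d₁)) (β : EuclideanSpace ℝ (Fin d₂)) :
    EuclideanSpace ℝ (Fin d₂) :=
  gradient (fun β' => g (α, β')) β

theorem gradSnd_eq_toDual_symm {d₁ d₂ : ℕ}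
    {g : EuclideanSpace ℝ (Fin d₁) × EuclideanSpace ℝ (Fin d₂) → ℝ} (hg : Differentiable ℝ g)
    (α : EuclideanSpace ℝ (Fin d₁)) (β : EuclideanSpace ℝ (Fin d₂)) :
    gradSnd g α β = (InnerProductSpace.toDual ℝ _).symm
      ((fderiv ℝ g (α, β)).comp (ContinuousLinearMap.inr ℝ _ _)) := by
  have h : HasFDerivAt (fun β' => g (α, β')) _ β :=
    (hg (α, β)).hasFDerivAt.comp β (hasFDerivAt_prodMk_right α β)
  rw [gradSnd, gradient, h.fderiv]

theorem differentiable_uncurry_gradSnd {d₁ d₂ : ℕ}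
    {g : EuclideanSpace ℝ (Fin d₁) × EuclideanSpace ℝ (Fin d₂) → ℝ} (hg : ContDiff ℝ 2 g) :
    Differentiable ℝ fun p : EuclideanSpace ℝ (Fin d₁) × EuclideanSpace ℝ (Fin d₂) =>
      gradSnd g p.1 p.2 := by
  simp only [gradSnd_eq_toDual_symm (hg.differentiable two_ne_zero)]
  have h : Differentiable ℝ (fderiv ℝ g) :=
    (hg.fderiv_right (m := 1) (by norm_num)).differentiable one_ne_zero
  exact (InnerProductSpace.toDual ℝ _).symm.differentiable.comp
    (h.clm_comp (differentiable_const _))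

/-- The total derivative of `α ↦ h (α, l α)` is the sum of its two partial contributions. -/
theorem hasFDerivAt_comp_graph {E F G : Type*} [NormedAddCommGroup E] [NormedSpace ℝ E]
    [NormedAddCommGroup F] [NormedSpace ℝ F] [NormedAddCommGroup G] [NormedSpace ℝ G]
    {h : E × F → G} {l : E → F} {a : E}
    (hh : DifferentiableAt ℝ h (a, l a)) (hl : DifferentiableAt ℝ l a) :
    HasFDerivAt (fun x => h (x, l x))
      (fderiv ℝ (fun x => h (x, l a)) a +
        (fderiv ℝ (fun y => h (a, y)) (l a)).comp (fderiv ℝ l a)) a := by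
  have h₁ : HasFDerivAt (fun x => h (x, l a)) _ a :=
    hh.hasFDerivAt.comp a (hasFDerivAt_prodMk_left a (l a))
  have h₂ : HasFDerivAt (fun y => h (a, y)) _ (l a) :=
    hh.hasFDerivAt.comp (l a) (hasFDerivAt_prodMk_right a (l a))
  have h₃ := HasFDerivAt.comp (f := fun x => (x, l x)) a hh.hasFDerivAt
    ((hasFDerivAt_id a).prodMk hl.hasFDerivAt)
  refine h₃.congr_fderiv ?_
  rw [h₁.fderiv, h₂.fderiv]
  ext w
  simp [← map_add]

/-- The Hessian of a `C²` function is symmetric. -/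
theorem inner_fderiv_gradient_comm {E : Type*} [NormedAddCommGroup E] [InnerProductSpace ℝ E]
    [CompleteSpace E] {h : E → ℝ} (hh : ContDiff ℝ 2 h) (x u v : E) :
    inner ℝ (fderiv ℝ (gradient h) x u) v = inner ℝ u (fderiv ℝ (gradient h) x v) := by
  have hd : DifferentiableAt ℝ (fderiv ℝ h) x :=
    (hh.fderiv_right (m := 1) (by norm_num)).differentiable one_ne_zero x
  have key : ∀ w, fderiv ℝ (gradient h) x w =
      (InnerProductSpace.toDual ℝ E).symm (fderiv ℝ (fderiv ℝ h) x w) := fun w => by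
    have hcomp := (InnerProductSpace.toDual ℝ E).symm.toContinuousLinearEquiv.hasFDerivAt.comp x
      hd.hasFDerivAt
    exact congrArg (fun T : E →L[ℝ] E => T w) hcomp.fderiv
  rw [key, key, real_inner_comm _ u, InnerProductSpace.toDual_symm_apply,
    InnerProductSpace.toDual_symm_apply]
  exact (hh.contDiffAt.isSymmSndFDerivAt (by simp)).eq u v

theorem stmt7 {d₁ d₂ : ℕ} (hd₁ : 1 ≤ d₁) (hd₂ : 1 ≤ d₂)
    (f : EuclideanSpace ℝ (Fin d₁) × EuclideanSpace ℝ (Fin d₂) → ℝ)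
    (hf : ContDiff ℝ 1 f)
    (g : EuclideanSpace ℝ (Fin d₁) × EuclideanSpace ℝ (Fin d₂) → ℝ)
    (hg : ContDiff ℝ 2 g)
    (lam : EuclideanSpace ℝ (Fin d₁) → EuclideanSpace ℝ (Fin d₂))
    (hlam : Differentiable ℝ lam)
    (hfoc : ∀ α, gradSnd g α (lam α) = 0)
    (α₀ : EuclideanSpace ℝ (Fin d₁))
    (J : EuclideanSpace ℝ (Fin d₂) ≃L[ℝ] EuclideanSpace ℝ (Fin d₂))
    (hJ : (J : EuclideanSpace ℝ (Fin d₂) →L[ℝ] EuclideanSpace ℝ (Fin d₂)) =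
      fderiv ℝ (fun β => gradSnd g α₀ β) (lam α₀)) :
    DifferentiableAt ℝ (fun α => f (α, lam α)) α₀ ∧
    gradient (fun α => f (α, lam α)) α₀ =
      gradient (fun α => f (α, lam α₀)) α₀ -
        (ContinuousLinearMap.adjoint (fderiv ℝ (fun α => gradSnd g α (lam α₀)) α₀))
          (J.symm (gradient (fun β => f (α₀, β)) (lam α₀))) := by
  have hF := hasFDerivAt_comp_graph (hf.differentiable one_ne_zero (α₀, lam α₀)) (hlam α₀)
  refine ⟨hF.differentiableAt, ext_inner_right ℝ fun w => ?_⟩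
  have hG := hasFDerivAt_comp_graph (differentiable_uncurry_gradSnd hg (α₀, lam α₀)) (hlam α₀)
  simp only [hfoc, ← hJ] at hG
  have hzero := congrArg (fun T => T w) (hG.unique (hasFDerivAt_const _ _))
  have hL : fderiv ℝ lam α₀ w =
      -J.symm (fderiv ℝ (fun α => gradSnd g α (lam α₀)) α₀ w) := by
    rw [← map_neg, ContinuousLinearEquiv.eq_symm_apply]
    exact eq_neg_of_add_eq_zero_right hzero
  have hsymm (u v : EuclideanSpace ℝ (Fin d₂)) : inner ℝ (J u) v = inner ℝ u (J v) := by
    have h := inner_fderiv_gradient_comm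
      (hg.comp (contDiff_const.prodMk contDiff_id : ContDiff ℝ 2 fun β => (α₀, β))) (lam α₀) u v
    change inner ℝ (fderiv ℝ (fun β => gradSnd g α₀ β) (lam α₀) u) v =
      inner ℝ u (fderiv ℝ (fun β => gradSnd g α₀ β) (lam α₀) v) at h
    rwa [← hJ] at h
  have hsymm' (u v : EuclideanSpace ℝ (Fin d₂)) :
      inner ℝ (J.symm u) v = inner ℝ u (J.symm v) := by
    simpa using (hsymm (J.symm u) (J.symm v)).symm
  rw [inner_sub_left, ContinuousLinearMap.adjoint_inner_left, hsymm']
  simp only [gradient, InnerProductSpace.toDual_symm_apply]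
  rw [hF.fderiv, add_apply, ContinuousLinearMap.comp_apply, hL, map_neg, sub_eq_add_neg]
end

section
/- Let (Ω, ℱ, P) be a probability space, let r > 0, C > 0, K ≥ 1, T₀ ≥ 1, and let S : [0,∞) × Ω → [0,∞) be such that S(t, ·) is measurable for every t, for P-almost every ω the map t ↦ S(t, ω) is nondecreasing, and E[S(t)²] ≤ C√t for every t ≥ T₀. Let γ : [0,∞) → (0,∞) be nonincreasing with γ(t) ≤ K γ(2t) for all t ≥ 0 and lim_{t→∞} γ²(t) t^{1/2 + 2r} = 0. Then for every δ ∈ (0, r), P-almost surely limsup_{t→∞} t^{r−δ} γ(t) S(t, ·) < ∞; in particular γ(t) S(t, ·) → 0 as t → ∞, P-almost surely. -/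
open Filter MeasureTheory

/-- Nonnegative integrable functions whose integrals have a summable majorant tend to `0`
almost everywhere. -/
theorem ae_tendsto_zero_of_integral_le_summable {Ω : Type*} [MeasurableSpace Ω] {μ : Measure Ω}
    {f : ℕ → Ω → ℝ} {b : ℕ → ℝ} (hf : ∀ n, Integrable (f n) μ) (hf0 : ∀ n ω, 0 ≤ f n ω)
    (hb : Summable b) (hfb : ∀ n, ∫ ω, f n ω ∂μ ≤ b n) :
    ∀ᵐ ω ∂μ, Tendsto (fun n => f n ω) atTop (nhds 0) := by
  have hmeas : ∀ n, AEMeasurable (fun ω => ENNReal.ofReal (f n ω)) μ := fun n =>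
    (hf n).aemeasurable.ennreal_ofReal
  have hfin : ∫⁻ ω, ∑' n, ENNReal.ofReal (f n ω) ∂μ ≠ ⊤ := by
    rw [lintegral_tsum hmeas]
    refine ne_top_of_le_ne_top hb.tsum_ofReal_ne_top (ENNReal.tsum_le_tsum fun n => ?_)
    rw [← ofReal_integral_eq_lintegral_ofReal (hf n) (Eventually.of_forall (hf0 n))]
    exact ENNReal.ofReal_le_ofReal (hfb n)
  filter_upwards [ae_lt_top' (AEMeasurable.tsum hmeas) hfin] with ω hω
  have h := (ENNReal.tendsto_toReal ENNReal.zero_ne_top).comp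
    (ENNReal.tendsto_atTop_zero_of_tsum_ne_top hω.ne)
  simpa [Function.comp_def, ENNReal.toReal_ofReal (hf0 _ ω)] using h

/-- If a nonnegative function on `[1, ∞)` is dominated on each dyadic interval
`[2 ^ n, 2 ^ (n + 1))` by a constant multiple of `x (n + 1)`, with `x` tending to `0`, then it
tends to `0` at infinity. -/
theorem tendsto_zero_of_dyadic_le {g : ℝ → ℝ} {x : ℕ → ℝ} {K : ℝ}
    (hg0 : ∀ t, 1 ≤ t → 0 ≤ g t) (hx : Tendsto x atTop (nhds 0))
    (hgx : ∀ (n : ℕ) (t : ℝ), 2 ^ n ≤ t → t < 2 ^ (n + 1) → g t ≤ K * x (n + 1)) :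
    Tendsto g atTop (nhds 0) := by
  have hK : Tendsto (fun n => K * x n) atTop (nhds 0) := by simpa using hx.const_mul K
  rw [Metric.tendsto_atTop] at hK ⊢
  intro ε hε
  obtain ⟨N, hN⟩ := hK ε hε
  refine ⟨2 ^ N, fun t ht => ?_⟩
  have ht1 : 1 ≤ t := (one_le_pow₀ one_le_two).trans ht
  obtain ⟨n, hn1, hn2⟩ := exists_nat_pow_near ht1 (one_lt_two : (1 : ℝ) < 2)
  have hNn : N < n + 1 := (pow_lt_pow_iff_right₀ (one_lt_two : (1 : ℝ) < 2)).1 (ht.trans_lt hn2)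
  have h1 := hN (n + 1) hNn.le
  rw [Real.dist_0_eq_abs] at h1 ⊢
  rw [abs_of_nonneg (hg0 t ht1)]
  exact ((hgx n t hn1 hn2).trans (le_abs_self _)).trans_lt h1

/-- A nondecreasing process with second moment of order `√t`, multiplied by a weight `γ` with
`γ ^ 2 * t ^ (1 / 2 + 2 * r) → 0` and by `t ^ (r - δ)`, tends to `0` almost surely. -/
theorem ae_tendsto_rpow_mul_weight_mul_zero {Ω : Type*} [MeasurableSpace Ω] {P : Measure Ω}
    {r C K T₀ δ : ℝ} (hC : 0 ≤ C) (hδ : 0 < δ) (hδr : δ ≤ r) {S : ℝ → Ω → ℝ}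
    (hSnn : ∀ t ≥ (0 : ℝ), ∀ ω, 0 ≤ S t ω)
    (hSmono : ∀ᵐ ω ∂P, MonotoneOn (fun t => S t ω) (Set.Ici (0 : ℝ)))
    (hSint : ∀ t ≥ T₀, Integrable (fun ω => (S t ω) ^ 2) P)
    (hSmom : ∀ t ≥ T₀, (∫ ω, (S t ω) ^ 2 ∂P) ≤ C * Real.sqrt t) {γ : ℝ → ℝ}
    (hγpos : ∀ t ≥ (0 : ℝ), 0 < γ t) (hγanti : AntitoneOn γ (Set.Ici (0 : ℝ)))
    (hγdbl : ∀ t ≥ (0 : ℝ), γ t ≤ K * γ (2 * t))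
    (hγlim : Tendsto (fun t => (γ t) ^ 2 * t ^ ((1 : ℝ) / 2 + 2 * r)) atTop (nhds 0)) :
    ∀ᵐ ω ∂P, Tendsto (fun t : ℝ => t ^ (r - δ) * (γ t * S t ω)) atTop (nhds 0) := by
  have hpow : Tendsto (fun n : ℕ => (2 : ℝ) ^ n) atTop atTop :=
    tendsto_pow_atTop_atTop_of_one_lt one_lt_two
  obtain ⟨N, hN⟩ := eventually_atTop.1 (hpow.eventually
    ((hγlim.eventually_le_const one_pos).and (eventually_ge_atTop T₀)))
  have hsum : Summable fun n : ℕ => C * ((2 : ℝ) ^ (-(2 * δ))) ^ (n + N) :=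
    ((summable_nat_add_iff N).2 (summable_geometric_of_lt_one (by positivity)
      (Real.rpow_lt_one_of_one_lt_of_neg one_lt_two (by linarith)))).mul_left C
  have hbound : ∀ n : ℕ, ∫ ω, (((2 : ℝ) ^ (n + N)) ^ (r - δ) * γ (2 ^ (n + N))) ^ 2 *
      S (2 ^ (n + N)) ω ^ 2 ∂P ≤ C * ((2 : ℝ) ^ (-(2 * δ))) ^ (n + N) := by
    intro n
    obtain ⟨h1, h2⟩ := hN (n + N) (Nat.le_add_left _ _)
    have ht : (0 : ℝ) < 2 ^ (n + N) := by positivity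
    rw [integral_const_mul, ← Real.rpow_mul_natCast zero_le_two, mul_comm (-(2 * δ)),
      Real.rpow_natCast_mul zero_le_two]
    generalize (2 : ℝ) ^ (n + N) = t at h1 h2 ht ⊢
    have hexp : (t ^ (r - δ)) ^ 2 * Real.sqrt t = t ^ (-(2 * δ)) * t ^ ((1 : ℝ) / 2 + 2 * r) := by
      rw [Real.sqrt_eq_rpow, ← Real.rpow_mul_natCast ht.le, ← Real.rpow_add ht,
        ← Real.rpow_add ht]
      congr 1
      push_cast
      ring
    calc (t ^ (r - δ) * γ t) ^ 2 * ∫ ω, S t ω ^ 2 ∂P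
        ≤ (t ^ (r - δ) * γ t) ^ 2 * (C * Real.sqrt t) :=
          mul_le_mul_of_nonneg_left (hSmom t h2) (sq_nonneg _)
      _ = C * γ t ^ 2 * ((t ^ (r - δ)) ^ 2 * Real.sqrt t) := by ring
      _ = C * t ^ (-(2 * δ)) * (γ t ^ 2 * t ^ ((1 : ℝ) / 2 + 2 * r)) := by rw [hexp]; ring
      _ ≤ C * t ^ (-(2 * δ)) := mul_le_of_le_one_right (by positivity) h1
  have hlim := ae_tendsto_zero_of_integral_le_summable
    (fun n => (hSint _ (hN (n + N) (Nat.le_add_left _ _)).2).const_mul _)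
    (fun n ω => by positivity) hsum hbound
  filter_upwards [hlim, hSmono] with ω hω hmono
  have hX : Tendsto (fun n : ℕ => ((2 : ℝ) ^ n) ^ (r - δ) * (γ (2 ^ n) * S (2 ^ n) ω))
      atTop (nhds 0) := by
    rw [← tendsto_add_atTop_iff_nat N]
    simp only [← mul_pow, mul_assoc] at hω
    have h := hω.sqrt
    simp only [Real.sqrt_sq_eq_abs, Real.sqrt_zero] at h
    exact (tendsto_zero_iff_abs_tendsto_zero _).2 h
  refine tendsto_zero_of_dyadic_le (K := K) (fun t ht => ?_) hX fun n t hn1 hn2 => ?_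
  · have ht0 : 0 ≤ t := zero_le_one.trans ht
    exact mul_nonneg (Real.rpow_nonneg ht0 _) (mul_nonneg (hγpos t ht0).le (hSnn t ht0 ω))
  · have ha : (0 : ℝ) ≤ 2 ^ n := by positivity
    have ht0 : 0 ≤ t := ha.trans hn1
    have hb : (0 : ℝ) ≤ 2 ^ (n + 1) := by positivity
    have hγ : γ t ≤ K * γ (2 ^ (n + 1)) := by
      rw [pow_succ']
      exact (hγanti ha ht0 hn1).trans (hγdbl _ ha)
    have hS : S t ω ≤ S (2 ^ (n + 1)) ω := hmono ht0 hb hn2.le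
    calc t ^ (r - δ) * (γ t * S t ω)
        ≤ (2 ^ (n + 1)) ^ (r - δ) * (K * γ (2 ^ (n + 1)) * S (2 ^ (n + 1)) ω) :=
          mul_le_mul (Real.rpow_le_rpow ht0 hn2.le (sub_nonneg.2 hδr))
            (mul_le_mul hγ hS (hSnn t ht0 ω) ((hγpos t ht0).le.trans hγ))
            (mul_nonneg (hγpos t ht0).le (hSnn t ht0 ω)) (by positivity)
      _ = K * ((2 ^ (n + 1)) ^ (r - δ) * (γ (2 ^ (n + 1)) * S (2 ^ (n + 1)) ω)) := by ring

theorem stmt9 {Ω : Type*} [MeasurableSpace Ω] (P : Measure Ω) [IsProbabilityMeasure P]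
    (r C K T₀ : ℝ) (hr : 0 < r) (hC : 0 < C) (hK : 1 ≤ K) (hT₀ : 1 ≤ T₀)
    (S : ℝ → Ω → ℝ)
    (hSmeas : ∀ t, Measurable (S t))
    (hSnn : ∀ t ≥ (0:ℝ), ∀ ω, 0 ≤ S t ω)
    (hSmono : ∀ᵐ ω ∂P, MonotoneOn (fun t => S t ω) (Set.Ici (0:ℝ)))
    (hSint : ∀ t ≥ T₀, Integrable (fun ω => (S t ω) ^ 2) P)
    (hSmom : ∀ t ≥ T₀, (∫ ω, (S t ω) ^ 2 ∂P) ≤ C * Real.sqrt t)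
    (γ : ℝ → ℝ)
    (hγpos : ∀ t ≥ (0:ℝ), 0 < γ t)
    (hγanti : AntitoneOn γ (Set.Ici (0:ℝ)))
    (hγdbl : ∀ t ≥ (0:ℝ), γ t ≤ K * γ (2 * t))
    (hγlim : Tendsto (fun t => (γ t) ^ 2 * t ^ ((1:ℝ)/2 + 2*r)) atTop (nhds 0)) :
    (∀ δ : ℝ, 0 < δ → δ < r →
      ∀ᵐ ω ∂P, IsBoundedUnder (· ≤ ·) atTop (fun t : ℝ => t ^ (r - δ) * (γ t * S t ω))) ∧
    (∀ᵐ ω ∂P, Tendsto (fun t => γ t * S t ω) atTop (nhds 0)) := by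
  have key : ∀ δ : ℝ, 0 < δ → δ ≤ r →
      ∀ᵐ ω ∂P, Tendsto (fun t : ℝ => t ^ (r - δ) * (γ t * S t ω)) atTop (nhds 0) :=
    fun δ hδ hδr => ae_tendsto_rpow_mul_weight_mul_zero hC.le hδ hδr hSnn hSmono hSint hSmom
      hγpos hγanti hγdbl hγlim
  refine ⟨fun δ hδ hδr => ?_, ?_⟩
  · filter_upwards [key δ hδ hδr.le] with ω hω using hω.isBoundedUnder_le
  · simpa using key r hr le_rfl
end
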